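/- arXiv:1911.10432 — 3 statements merged into one kernel-verified Lean document; each statement's English description precedes it below -/
import Mathlib

section
/- Let n ≥ 0 and let x, y ∈ ℝ^{n+2} satisfy ⟨x,x⟩₋₁ = 1, x₀ > 0, ⟨y,y⟩₋₁ = −1, ⟨x,y⟩₋₁ = 0, and additionally the Euclidean orthogonality condition ⟨x,y⟩₁ = 0. Let t ∈ ℝ and set z = x cosh t + y sinh t and w = x sinh t + y cosh t. If ⟨z,w⟩₁ = 0, then t = 0; consequently z = x and w = y. (This is the well-definedness of the embedding f : L(H^{n+1}) → TH^{n+1}, x∧y ↦ (x,−y): any two normalized representatives of the same oriented geodesic coincide.) -/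
/-- The Minkowski bilinear form `⟨u,v⟩₋₁ = u₀v₀ − Σ_{i=1}^{n+1} uᵢvᵢ` on `ℝ^{n+2}`. -/
noncomputable def mink {n : ℕ} (u v : Fin (n + 2) → ℝ) : ℝ :=
  u 0 * v 0 - ∑ i : Fin (n + 1), u i.succ * v i.succ

/-- The Euclidean bilinear form `⟨u,v⟩₁ = Σ_{i=0}^{n+1} uᵢvᵢ` on `ℝ^{n+2}`. -/
noncomputable def eucl {n : ℕ} (u v : Fin (n + 2) → ℝ) : ℝ :=
  ∑ i : Fin (n + 2), u i * v i

theorem eucl_hyperbolic_rotation {n : ℕ} (x y : Fin (n + 2) → ℝ) (c s : ℝ) :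
    eucl (c • x + s • y) (s • x + c • y) =
      s * c * (eucl x x + eucl y y) + (c ^ 2 + s ^ 2) * eucl x y := by
  simp only [eucl, ← Finset.sum_add_distrib, Finset.mul_sum]
  refine Finset.sum_congr rfl fun i _ => ?_
  simp only [Pi.add_apply, Pi.smul_apply, smul_eq_mul]
  ring

theorem eucl_self_nonneg {n : ℕ} (u : Fin (n + 2) → ℝ) : 0 ≤ eucl u u :=
  Finset.sum_nonneg fun i _ => mul_self_nonneg (u i)

theorem eucl_self_pos {n : ℕ} {u : Fin (n + 2) → ℝ} (h : 0 < u 0) : 0 < eucl u u :=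
  Finset.sum_pos' (fun i _ => mul_self_nonneg (u i)) ⟨0, Finset.mem_univ 0, mul_pos h h⟩

/-- Well-definedness of the embedding `f : L(H^{n+1}) → TH^{n+1}`, `x∧y ↦ (x,−y)`:
any two normalized representatives of the same oriented geodesic coincide. -/
theorem normalized_representative_unique (n : ℕ) (x y : Fin (n + 2) → ℝ) (t : ℝ)
    (hxx : mink x x = 1) (hx0 : x 0 > 0) (hyy : mink y y = -1)
    (hxy : mink x y = 0) (hxyE : eucl x y = 0)
    (z w : Fin (n + 2) → ℝ)
    (hz : z = Real.cosh t • x + Real.sinh t • y)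
    (hw : w = Real.sinh t • x + Real.cosh t • y)
    (hzw : eucl z w = 0) :
    t = 0 ∧ z = x ∧ w = y := by
  have ht : t = 0 := by
    rw [hz, hw, eucl_hyperbolic_rotation, hxyE, mul_zero, add_zero] at hzw
    have hpos := add_pos_of_pos_of_nonneg (eucl_self_pos hx0) (eucl_self_nonneg y)
    have hsc := (mul_eq_zero.mp hzw).resolve_right hpos.ne'
    exact Real.sinh_eq_zero.mp ((mul_eq_zero.mp hsc).resolve_right (Real.cosh_pos t).ne')
  subst ht
  simp [hz, hw]
end

section
/- Let n ≥ 0 and let a, b ∈ ℝ^{n+2} satisfy ⟨a,a⟩₋₁ = 1, a₀ > 0, ⟨b,b⟩₋₁ = −1, ⟨a,b⟩₋₁ = 0. Then there exists a unique t ∈ ℝ such that the pair x_t = a cosh t + b sinh t, y_t = a sinh t + b cosh t satisfies ⟨x_t, y_t⟩₁ = 0. (Every oriented geodesic of H^{n+1} has exactly one normalized representative, so the map x∧y ↦ (x,−y) identifies L(H^{n+1}) with a subset of TH^{n+1}.) -/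
theorem eucl_eq_two_mul_sub_mink {n : ℕ} (u v : Fin (n + 2) → ℝ) :
    eucl u v = 2 * (u 0 * v 0) - mink u v := by
  rw [eucl, mink, Fin.sum_univ_succ]
  ring

theorem mink_smul_add_smul {n : ℕ} (p q r s : ℝ) (a b : Fin (n + 2) → ℝ) :
    mink (p • a + q • b) (r • a + s • b) =
      p * r * mink a a + (p * s + q * r) * mink a b + q * s * mink b b := by
  have h : ∑ i : Fin (n + 1), (p * a i.succ + q * b i.succ) * (r * a i.succ + s * b i.succ) =
      p * r * ∑ i : Fin (n + 1), a i.succ * a i.succ +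
        (p * s + q * r) * ∑ i : Fin (n + 1), a i.succ * b i.succ +
        q * s * ∑ i : Fin (n + 1), b i.succ * b i.succ := by
    simp only [Finset.mul_sum, ← Finset.sum_add_distrib]
    exact Finset.sum_congr rfl fun i _ => by ring
  simp only [mink, Pi.add_apply, Pi.smul_apply, smul_eq_mul, h]
  ring

/-- The time component of a unit timelike vector strictly dominates that of any
Minkowski-orthogonal unit spacelike vector. -/
theorem abs_apply_zero_lt_of_mink_eq_zero {n : ℕ} {a b : Fin (n + 2) → ℝ}
    (haa : mink a a = 1) (ha0 : 0 < a 0) (hbb : mink b b = -1) (hab : mink a b = 0) :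
    |b 0| < a 0 := by
  have hcs := Finset.sum_mul_sq_le_sq_mul_sq Finset.univ
    (fun i : Fin (n + 1) => a i.succ) (fun i => b i.succ)
  simp only [mink] at haa hbb hab
  simp only [pow_two (a _), pow_two (b _)] at hcs
  rw [← sub_eq_zero.mp hab,
    show ∑ i : Fin (n + 1), a i.succ * a i.succ = a 0 * a 0 - 1 by linarith,
    show ∑ i : Fin (n + 1), b i.succ * b i.succ = b 0 * b 0 + 1 by linarith] at hcs
  exact abs_lt_of_sq_lt_sq (by nlinarith) ha0.le

/-- The equation `p sinh t + q cosh t = 0` in exponential form. -/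
theorem mul_sinh_add_mul_cosh_eq_zero_iff {p q : ℝ} (h : |q| < p) (t : ℝ) :
    p * Real.sinh t + q * Real.cosh t = 0 ↔ t = Real.log ((p - q) / (p + q)) / 2 := by
  obtain ⟨h₁, h₂⟩ := abs_lt.mp h
  have hadd : 0 < p + q := by linarith
  have hpos : 0 < (p - q) / (p + q) := div_pos (by linarith) hadd
  have hexp : Real.exp (2 * t) = Real.exp t * Real.exp t := by rw [two_mul, Real.exp_add]
  have hfac : 2 * Real.exp t * (p * Real.sinh t + q * Real.cosh t) =
      Real.exp (2 * t) * (p + q) - (p - q) := by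
    have hinv : Real.exp t * Real.exp (-t) = 1 := by rw [← Real.exp_add]; simp
    rw [Real.sinh_eq, Real.cosh_eq, hexp]
    linear_combination (q - p) * hinv
  have hne : 2 * Real.exp t ≠ 0 := by positivity
  calc p * Real.sinh t + q * Real.cosh t = 0
      ↔ Real.exp (2 * t) * (p + q) - (p - q) = 0 := by
        rw [← hfac, mul_eq_zero, or_iff_right hne]
    _ ↔ Real.exp (2 * t) = (p - q) / (p + q) := by rw [sub_eq_zero, eq_div_iff hadd.ne']
    _ ↔ 2 * t = Real.log ((p - q) / (p + q)) := by
        rw [← Real.exp_eq_exp (x := 2 * t), Real.exp_log hpos]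
    _ ↔ t = Real.log ((p - q) / (p + q)) / 2 := by
        constructor <;> intro h <;> linarith

theorem mul_cosh_add_mul_sinh_pos {p q : ℝ} (h : |q| < p) (t : ℝ) :
    0 < p * Real.cosh t + q * Real.sinh t := by
  obtain ⟨h₁, h₂⟩ := abs_lt.mp h
  have hsum : p * Real.cosh t + q * Real.sinh t =
      ((p + q) * Real.exp t + (p - q) * Real.exp (-t)) / 2 := by
    rw [Real.sinh_eq, Real.cosh_eq]
    ring
  have hadd : 0 < p + q := by linarith
  have hsub : 0 < p - q := by linarith
  rw [hsum]
  positivity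

/-- Every oriented geodesic of `H^{n+1}` has exactly one normalized representative. -/
theorem exists_unique_normalized_representative (n : ℕ) (a b : Fin (n + 2) → ℝ)
    (haa : mink a a = 1) (ha0 : a 0 > 0) (hbb : mink b b = -1) (hab : mink a b = 0) :
    ∃! t : ℝ,
      eucl (Real.cosh t • a + Real.sinh t • b) (Real.sinh t • a + Real.cosh t • b) = 0 := by
  have hlt := abs_apply_zero_lt_of_mink_eq_zero haa ha0 hbb hab
  have key (t : ℝ) :
      eucl (Real.cosh t • a + Real.sinh t • b) (Real.sinh t • a + Real.cosh t • b) = 0 ↔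
        t = Real.log ((a 0 - b 0) / (a 0 + b 0)) / 2 := by
    have hx := mul_cosh_add_mul_sinh_pos hlt t
    have heucl : eucl (Real.cosh t • a + Real.sinh t • b) (Real.sinh t • a + Real.cosh t • b) =
        2 * (a 0 * Real.cosh t + b 0 * Real.sinh t) *
          (a 0 * Real.sinh t + b 0 * Real.cosh t) := by
      rw [eucl_eq_two_mul_sub_mink, mink_smul_add_smul, haa, hab, hbb]
      simp only [Pi.add_apply, Pi.smul_apply, smul_eq_mul]
      ring
    rw [heucl, mul_eq_zero, or_iff_right (by positivity),
      mul_sinh_add_mul_cosh_eq_zero_iff hlt]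
  exact ⟨_, (key _).mpr rfl, fun t ht => (key t).mp ht⟩
end

section
/- Let c ∈ {−1, 1}, n ≥ 1, let U ⊆ ℝⁿ be open, and let φ, N : U → ℝ^{n+2} be smooth maps satisfying, at every point of U: ⟨φ,φ⟩_c = 1, ⟨N,N⟩_c = c, ⟨φ,N⟩_c = 0, and ⟨N, ∂_iφ⟩_c = 0 for i = 1,…,n (φ is a hypersurface of S^{n+1}(c) with unit normal N; its Gauss map is Φ = φ∧N, whose derivative is dΦ(∂_i) = φ∧(∂_iN) + N∧(−∂_iφ)). Then for all i, j: (a) ∂_iN and ∂_iφ are ⟨·,·⟩_c-orthogonal to both φ and N, and the pullback of the metric 𝒢 under Φ satisfies 𝒢(dΦ(∂_i), dΦ(∂_j)) = −⟨∂_iN, ∂_jφ⟩_c − ⟨∂_jN, ∂_iφ⟩_c = 2⟨N, ∂_i∂_jφ⟩_c, i.e. twice the second fundamental form of φ; and (b) the pullback of the symplectic form Ω vanishes: Ω(dΦ(∂_i), dΦ(∂_j)) = ⟨∂_jN, ∂_iφ⟩_c − ⟨∂_iN, ∂_jφ⟩_c = 0, i.e. the Gauss map is a Lagrangian immersion. 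-/
/-- The bilinear form `⟨u,v⟩_c` of the real space form model `S^{n+1}(c)` on `ℝ^{n+2}`:
Euclidean for `c = 1`, Minkowski for `c = −1`. -/
noncomputable def form {n : ℕ} (c : ℝ) (u v : Fin (n + 2) → ℝ) : ℝ :=
  u 0 * v 0 + c * ∑ i : Fin (n + 1), u i.succ * v i.succ

theorem form_comm {n : ℕ} (c : ℝ) (u v : Fin (n + 2) → ℝ) : form c u v = form c v u := by
  simp only [form, mul_comm]

/-- The Leibniz rule for `form` along a line. -/
theorem hasDerivAt_form {n : ℕ} (c : ℝ) {f g : ℝ → Fin (n + 2) → ℝ} {f' g' : Fin (n + 2) → ℝ}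
    {t : ℝ} (hf : HasDerivAt f f' t) (hg : HasDerivAt g g' t) :
    HasDerivAt (fun s => form c (f s) (g s))
      (form c f' (g t) + form c (f t) g') t := by
  rw [hasDerivAt_pi] at hf hg
  have h := ((hf 0).mul (hg 0)).add
    ((HasDerivAt.fun_sum (u := Finset.univ) fun (i : Fin (n + 1)) _ =>
      (hf i.succ).mul (hg i.succ)).const_mul c)
  refine h.congr_deriv ?_
  simp only [form, Finset.sum_add_distrib]
  ring

theorem form_fderiv_add_form_fderiv_eq_zero {E : Type*} [NormedAddCommGroup E] [NormedSpace ℝ E]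
    {n : ℕ} {c a : ℝ} {U : Set E} (hU : IsOpen U) {f g : E → Fin (n + 2) → ℝ} {p : E} (hp : p ∈ U)
    (hf : DifferentiableAt ℝ f p) (hg : DifferentiableAt ℝ g p)
    (h : ∀ q ∈ U, form c (f q) (g q) = a) (v : E) :
    form c (fderiv ℝ f p v) (g p) + form c (f p) (fderiv ℝ g p v) = 0 := by
  have hline : HasDerivAt (fun t : ℝ => p + t • v) v 0 := by
    simpa using ((hasDerivAt_id (0 : ℝ)).smul_const v).const_add p
  have hf' : HasDerivAt (fun t : ℝ => f (p + t • v)) (fderiv ℝ f p v) 0 :=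
    HasFDerivAt.comp_hasDerivAt (0 : ℝ) (by simpa using hf.hasFDerivAt) hline
  have hg' : HasDerivAt (fun t : ℝ => g (p + t • v)) (fderiv ℝ g p v) 0 :=
    HasFDerivAt.comp_hasDerivAt (0 : ℝ) (by simpa using hg.hasFDerivAt) hline
  have hmem : ∀ᶠ t : ℝ in nhds 0, p + t • v ∈ U :=
    hline.continuousAt.eventually_mem (hU.mem_nhds (by simpa using hp))
  have hconst : HasDerivAt (fun t : ℝ => form c (f (p + t • v)) (g (p + t • v))) 0 0 :=
    (hasDerivAt_const (0 : ℝ) a).congr_of_eventuallyEq (hmem.mono fun t ht => h _ ht)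
  simpa using (hasDerivAt_form c hf' hg').unique hconst

/-- The Gauss map `Φ = φ∧N` of a hypersurface `φ` of `S^{n+1}(c)` with unit normal `N`:
(a) its derivatives `∂_iφ, ∂_iN` are tangent (orthogonal to `φ` and `N`), the induced
metric is `𝒢(dΦ∂_i, dΦ∂_j) = −⟨∂_iN,∂_jφ⟩_c − ⟨∂_jN,∂_iφ⟩_c = 2⟨N,∂_i∂_jφ⟩_c`,
twice the second fundamental form; (b) the pullback of the symplectic form `Ω`
vanishes, i.e. the Gauss map is a Lagrangian immersion. -/
theorem gauss_map_is_lagrangian (c : ℝ) (hc : c = 1 ∨ c = -1)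
    (n : ℕ) (hn : 1 ≤ n)
    (U : Set (Fin n → ℝ)) (hU : IsOpen U)
    (φ N : (Fin n → ℝ) → Fin (n + 2) → ℝ)
    (hφ : ContDiffOn ℝ (⊤ : ℕ∞) φ U) (hN : ContDiffOn ℝ (⊤ : ℕ∞) N U)
    (hφφ : ∀ p ∈ U, form c (φ p) (φ p) = 1)
    (hNN : ∀ p ∈ U, form c (N p) (N p) = c)
    (hφN : ∀ p ∈ U, form c (φ p) (N p) = 0)
    (hnormal : ∀ p ∈ U, ∀ i : Fin n,
      form c (N p) (fderiv ℝ φ p (Pi.single i 1)) = 0) :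
    ∀ p ∈ U, ∀ i j : Fin n,
      -- (a) tangency of the derivatives …
      (form c (φ p) (fderiv ℝ φ p (Pi.single i 1)) = 0 ∧
       form c (N p) (fderiv ℝ φ p (Pi.single i 1)) = 0 ∧
       form c (φ p) (fderiv ℝ N p (Pi.single i 1)) = 0 ∧
       form c (N p) (fderiv ℝ N p (Pi.single i 1)) = 0) ∧
      -- … and the induced metric is twice the second fundamental form
      (-(form c (fderiv ℝ N p (Pi.single i 1)) (fderiv ℝ φ p (Pi.single j 1)))
          - form c (fderiv ℝ N p (Pi.single j 1)) (fderiv ℝ φ p (Pi.single i 1))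
        = 2 * form c (N p)
            (fderiv ℝ (fun q => fderiv ℝ φ q (Pi.single i 1)) p (Pi.single j 1))) ∧
      -- (b) the pullback of the symplectic form Ω vanishes
      (form c (fderiv ℝ N p (Pi.single j 1)) (fderiv ℝ φ p (Pi.single i 1))
          - form c (fderiv ℝ N p (Pi.single i 1)) (fderiv ℝ φ p (Pi.single j 1)) = 0) := by
  intro p hp i j
  have hφp : ContDiffAt ℝ (⊤ : ℕ∞) φ p := hφ.contDiffAt (hU.mem_nhds hp)
  have hNp : ContDiffAt ℝ (⊤ : ℕ∞) N p := hN.contDiffAt (hU.mem_nhds hp)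
  have dφ : DifferentiableAt ℝ φ p := hφp.differentiableAt (by simp)
  have dN : DifferentiableAt ℝ N p := hNp.differentiableAt (by simp)
  have ddφ : DifferentiableAt ℝ (fderiv ℝ φ) p :=
    (hφp.fderiv_right (m := 1) (by norm_cast)).differentiableAt (by simp)
  have hsymm : IsSymmSndFDerivAt ℝ φ p :=
    hφp.isSymmSndFDerivAt (by
      simp only [minSmoothness_of_isRCLikeNormedField]
      exact WithTop.coe_le_coe.2 le_top)
  have hsnd (v w : Fin n → ℝ) :
      fderiv ℝ (fun q => fderiv ℝ φ q v) p w = fderiv ℝ (fderiv ℝ φ) p w v := by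
    rw [fderiv_clm_apply ddφ (differentiableAt_const v)]
    simp
  have hcross (k l : Fin n) :
      form c (fderiv ℝ N p (Pi.single l 1)) (fderiv ℝ φ p (Pi.single k 1)) +
        form c (N p) (fderiv ℝ (fun q => fderiv ℝ φ q (Pi.single k 1)) p (Pi.single l 1)) = 0 :=
    form_fderiv_add_form_fderiv_eq_zero hU hp dN (ddφ.clm_apply (differentiableAt_const _))
      (fun q hq => hnormal q hq k) _
  have hji := hcross i j
  have hij := hcross j i
  rw [hsnd, hsymm.eq, ← hsnd] at hij
  have hφφ' := form_fderiv_add_form_fderiv_eq_zero hU hp dφ dφ hφφ (Pi.single i 1)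
  have hNN' := form_fderiv_add_form_fderiv_eq_zero hU hp dN dN hNN (Pi.single i 1)
  have hφN' := form_fderiv_add_form_fderiv_eq_zero hU hp dφ dN hφN (Pi.single i 1)
  rw [form_comm] at hφφ' hNN' hφN'
  have hNφ := hnormal p hp i
  refine ⟨⟨?_, hNφ, ?_, ?_⟩, ?_, ?_⟩ <;> linarith
end
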